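/- For nonnegative integers ℓ, m, k, and the bi-differential operator B(F)(z) = Σ_{r+s=k} (-1)^r · C(ℓ+k-1, s) · C(m+k-1, r) · ∂_z^r ∂_w^s F(z,w)|_{z=w} acting on holomorphic functions on Π×Π (Π the upper half plane), and the representations π_k(g)F(z) = (cz+d)^{-k} F((az+b)/(cz+d)) where g^{-1} = [[a,b],[c,d]] ∈ SL(2,ℝ), we have B ∘ (π_ℓ(g) ⊗ π_m(g)) = π_{ℓ+m+2k}(g) ∘ B for all g ∈ SL(2,ℝ). -/

import Mathlib

set_option autoImplicit false

open Complex Finset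

/-- The upper half plane, as a subset of `ℂ`. -/
def UHP : Set ℂ := {z : ℂ | 0 < z.im}

/-- Partial derivative in the first variable of a function on `ℂ × ℂ`. -/
noncomputable def dz (F : ℂ × ℂ → ℂ) : ℂ × ℂ → ℂ := fun p => fderiv ℂ F p (1, 0)

/-- Partial derivative in the second variable of a function on `ℂ × ℂ`. -/
noncomputable def dw (F : ℂ × ℂ → ℂ) : ℂ × ℂ → ℂ := fun p => fderiv ℂ F p (0, 1)

/-- The Rankin–Cohen bracket
`B_{ℓ,m}^{(k)} F (z) = ∑_{r+s=k} (-1)^r C(ℓ+k-1, s) C(m+k-1, r) ∂_z^r ∂_w^s F (z,w)|_{z=w}`. -/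
noncomputable def RC (ℓ m k : ℕ) (F : ℂ × ℂ → ℂ) : ℂ → ℂ := fun z =>
  ∑ r ∈ range (k + 1),
    (-1 : ℂ) ^ r * (Nat.choose (ℓ + k - 1) (k - r) : ℂ) * (Nat.choose (m + k - 1) r : ℂ) *
      (dz^[r] (dw^[k - r] F)) (z, z)

/-- The Möbius action of `h ∈ SL(2,ℝ)` on `ℂ`, `h·z = (az+b)/(cz+d)` where
`h = [[a,b],[c,d]]`. -/
noncomputable def mob (h : Matrix.SpecialLinearGroup (Fin 2) ℝ) (z : ℂ) : ℂ :=
  (((h : Matrix (Fin 2) (Fin 2) ℝ) 0 0 : ℂ) * z + ((h : Matrix (Fin 2) (Fin 2) ℝ) 0 1 : ℂ)) /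
    (((h : Matrix (Fin 2) (Fin 2) ℝ) 1 0 : ℂ) * z + ((h : Matrix (Fin 2) (Fin 2) ℝ) 1 1 : ℂ))

/-- The denominator `cz + d` for `h = [[a,b],[c,d]] ∈ SL(2,ℝ)`. -/
noncomputable def den (h : Matrix.SpecialLinearGroup (Fin 2) ℝ) (z : ℂ) : ℂ :=
  ((h : Matrix (Fin 2) (Fin 2) ℝ) 1 0 : ℂ) * z + ((h : Matrix (Fin 2) (Fin 2) ℝ) 1 1 : ℂ)

/-- The weight-`k` action of `g ∈ SL(2,ℝ)` on holomorphic functions on the upper half plane: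
`π_k(g) F (z) = (cz+d)^{-k} F((az+b)/(cz+d))` where `g⁻¹ = [[a,b],[c,d]]`. -/
noncomputable def piAct (k : ℕ) (g : Matrix.SpecialLinearGroup (Fin 2) ℝ) (F : ℂ → ℂ) :
    ℂ → ℂ := fun z => den g⁻¹ z ^ (-(k : ℤ)) * F (mob g⁻¹ z)

/-- The tensor product action `π_ℓ(g) ⊗ π_m(g)` on functions on `Π × Π`. -/
noncomputable def piTensorAct (ℓ m : ℕ) (g : Matrix.SpecialLinearGroup (Fin 2) ℝ)
    (F : ℂ × ℂ → ℂ) : ℂ × ℂ → ℂ := fun p =>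
  den g⁻¹ p.1 ^ (-(ℓ : ℤ)) * den g⁻¹ p.2 ^ (-(m : ℤ)) * F (mob g⁻¹ p.1, mob g⁻¹ p.2)

theorem reg_fderiv {U : Set (ℂ × ℂ)} (hU : IsOpen U) {F : ℂ × ℂ → ℂ}
    (hF : DifferentiableOn ℂ F U) (v : ℂ × ℂ) :
    DifferentiableOn ℂ (fun p => fderiv ℂ F p v) U := by
  intro p0 hp0
  apply DifferentiableAt.differentiableWithinAt
  have hcont : ContinuousAt F p0 := (hF.differentiableAt (hU.mem_nhds hp0)).continuousAt
  obtain ⟨ε, hε, hball⟩ : ∃ ε > 0, ∀ q ∈ Metric.ball p0 ε, q ∈ U ∧ dist (F q) (F p0) < 1 := by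
    have h1 : ∀ᶠ q in nhds p0, q ∈ U ∧ dist (F q) (F p0) < 1 :=
      (hU.eventually_mem hp0).and (Metric.tendsto_nhds.1 hcont 1 one_pos)
    exact Metric.eventually_nhds_iff_ball.1 h1
  set δ := ε / 4 with hδ
  have hδ0 : 0 < δ := by positivity
  have hdiffAt : ∀ q ∈ Metric.ball p0 ε, DifferentiableAt ℂ F q := fun q hq =>
    hF.differentiableAt (hU.mem_nhds (hball q hq).1)
  have hbd : ∀ q ∈ Metric.ball p0 (2 * δ), ‖fderiv ℂ F q‖ ≤ 2 / (2 * δ) := by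
    intro q hq
    have hsub : Metric.ball q (2 * δ) ⊆ Metric.ball p0 ε := by
      apply Metric.ball_subset_ball'
      have := Metric.mem_ball.1 hq
      linarith
    apply Complex.norm_fderiv_le_div_of_mapsTo_ball
    · intro x hx
      exact (hdiffAt x (hsub hx)).differentiableWithinAt
    · intro x hx
      rw [Metric.mem_closedBall]
      have h1 := (hball x (hsub hx)).2
      have h2 := (hball q (hsub (Metric.mem_ball_self (by positivity)))).2
      have := dist_triangle_right (F x) (F q) (F p0)
      linarith
    · positivity
  set R := δ / (‖v‖ + 1) with hR
  have hR0 : 0 < R := by positivity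
  have hRv : R * ‖v‖ ≤ δ := by
    rw [hR, div_mul_eq_mul_div, div_le_iff₀ (by positivity)]
    nlinarith [norm_nonneg v]
  have hin : ∀ p ∈ Metric.ball p0 δ, ∀ t : ℂ, ‖t‖ ≤ R → p + t • v ∈ Metric.ball p0 (2 * δ) := by
    intro p hp t ht
    rw [Metric.mem_ball, dist_eq_norm] at *
    calc ‖p + t • v - p0‖ = ‖(p - p0) + t • v‖ := by congr 1; abel
      _ ≤ ‖p - p0‖ + ‖t • v‖ := norm_add_le _ _
      _ ≤ ‖p - p0‖ + R * ‖v‖ := by rw [norm_smul]; gcongr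
      _ < 2 * δ := by linarith
  have hsub2 : Metric.ball p0 (2 * δ) ⊆ Metric.ball p0 ε :=
    Metric.ball_subset_ball (by linarith)
  -- Cauchy formula
  have hC : ∀ p ∈ Metric.ball p0 δ, fderiv ℂ F p v =
      (2 * Real.pi * I)⁻¹ * ∮ t in C(0, R), (1 / (t - 0) ^ 2) • F (p + t • v) := by
    intro p hp
    have hder : ∀ t : ℂ, ‖t‖ ≤ R →
        HasDerivAt (fun t : ℂ => F (p + t • v)) (fderiv ℂ F (p + t • v) v) t := by
      intro t ht
      have h1 := (hdiffAt _ (hsub2 (hin p hp t ht))).hasFDerivAt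
      have h2 : HasDerivAt (fun t : ℂ => p + t • v) v t := by
        simpa using ((hasDerivAt_id t).smul_const v).const_add p
      exact h1.comp_hasDerivAt t h2
    have hd : DifferentiableOn ℂ (fun t : ℂ => F (p + t • v)) (Metric.closedBall 0 R) := by
      intro t ht
      exact (hder t (by simpa using ht)).differentiableAt.differentiableWithinAt
    rw [hd.deriv_eq_smul_circleIntegral hR0, (hder 0 (by simpa using hR0.le)).deriv]
    simp only [zero_smul, add_zero, smul_eq_mul]
    rw [inv_mul_cancel_left₀ Complex.two_pi_I_ne_zero]
  have hkey : DifferentiableAt ℂ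
      (fun p => ∮ t in C(0, R), (1 / (t - 0) ^ 2) • F (p + t • v)) p0 := by
    unfold circleIntegral
    simp only [intervalIntegral.integral_of_le Real.two_pi_pos.le]
    have hcm : ∀ θ, ‖circleMap 0 R θ‖ ≤ R := by
      intro θ; simp [abs_of_pos hR0]
    have hFc : ∀ p ∈ Metric.ball p0 δ, Continuous (fun θ : ℝ => deriv (circleMap 0 R) θ •
        (1 / (circleMap 0 R θ - 0) ^ 2) • F (p + circleMap 0 R θ • v)) := by
      intro p hp
      have h1 : Continuous (fun θ : ℝ => F (p + circleMap 0 R θ • v)) := by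
        rw [continuous_iff_continuousAt]
        intro θ
        have := (hdiffAt _ (hsub2 (hin p hp _ (hcm θ)))).continuousAt
        refine ContinuousAt.comp (f := fun θ : ℝ => p + circleMap 0 R θ • v) this ?_
        have := continuous_circleMap 0 R
        fun_prop
      have h2 : Continuous (circleMap 0 R) := continuous_circleMap 0 R
      have h3 : Continuous (fun θ : ℝ => 1 / (circleMap 0 R θ - 0) ^ 2) := by
        refine continuous_const.div (by fun_prop) ?_
        intro θ
        simp [hR0.ne']
      simp only [deriv_circleMap]
      exact (h2.mul continuous_const).smul (h3.smul h1)
    refine (hasFDerivAt_integral_of_dominated_of_fderiv_le (𝕜 := ℂ)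
      (F' := fun p θ => (deriv (circleMap 0 R) θ * (1 / (circleMap 0 R θ - 0) ^ 2)) •
        fderiv ℂ F (p + circleMap 0 R θ • v))
      (bound := fun _ => (R * (1 / R ^ 2)) * (2 / (2 * δ)))
      (Metric.ball_mem_nhds p0 hδ0) ?_ ?_ ?_ ?_ ?_ ?_).differentiableAt
    · filter_upwards [Metric.ball_mem_nhds p0 hδ0] with p hp
      exact (hFc p hp).aestronglyMeasurable
    · exact ((hFc p0 (Metric.mem_ball_self hδ0)).integrableOn_Icc).mono_set
        Set.Ioc_subset_Icc_self
    · apply Measurable.aestronglyMeasurable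
      have h2 : Measurable (circleMap 0 R) := (continuous_circleMap 0 R).measurable
      have h3 : Measurable (fun θ => fderiv ℂ F (p0 + circleMap 0 R θ • v)) :=
        (measurable_fderiv ℂ F).comp
          (by have := continuous_circleMap 0 R; exact Continuous.measurable (by fun_prop))
      simp only [deriv_circleMap]
      have h4 : Measurable (fun θ => circleMap 0 R θ * I * (1 / (circleMap 0 R θ - 0) ^ 2)) := by
        fun_prop
      exact h4.smul h3
    · refine Filter.Eventually.of_forall fun θ p hp => ?_
      rw [norm_smul]
      refine mul_le_mul (le_of_eq ?_) (hbd _ (hin p hp _ (hcm θ))) (norm_nonneg _) (by positivity)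
      simp [deriv_circleMap, abs_of_pos hR0]
    · exact MeasureTheory.integrable_const _
    · refine Filter.Eventually.of_forall fun θ p hp => ?_
      have h1 := (hdiffAt _ (hsub2 (hin p hp _ (hcm θ)))).hasFDerivAt
      have h2 : HasFDerivAt (fun p : ℂ × ℂ => p + circleMap 0 R θ • v)
        (ContinuousLinearMap.id ℂ (ℂ × ℂ)) p := (hasFDerivAt_id p).add_const _
      have h3 := (h1.comp p h2).const_smul
        (deriv (circleMap 0 R) θ * (1 / (circleMap 0 R θ - 0) ^ 2))
      refine h3.congr_of_eventuallyEq (Filter.Eventually.of_forall fun x => ?_)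
      simp only [Pi.smul_apply, Function.comp_apply, smul_eq_mul, mul_assoc]
  have hkey2 := hkey.const_mul ((2 * Real.pi * I)⁻¹)
  refine hkey2.congr_of_eventuallyEq ?_
  filter_upwards [Metric.ball_mem_nhds p0 hδ0] with p hp
  exact hC p hp

noncomputable def DD (v : ℂ × ℂ) (F : ℂ × ℂ → ℂ) : ℂ × ℂ → ℂ := fun p => fderiv ℂ F p v

theorem DD_congr {U : Set (ℂ × ℂ)} (hU : IsOpen U) (v : ℂ × ℂ) {f g : ℂ × ℂ → ℂ}
    (h : Set.EqOn f g U) : Set.EqOn (DD v f) (DD v g) U := by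
  intro p hp
  have : f =ᶠ[nhds p] g := Filter.eventuallyEq_of_mem (hU.mem_nhds hp) h
  simp only [DD, this.fderiv_eq]

theorem DD_iter_congr {U : Set (ℂ × ℂ)} (hU : IsOpen U) (v : ℂ × ℂ) (n : ℕ) {f g : ℂ × ℂ → ℂ}
    (h : Set.EqOn f g U) : Set.EqOn ((DD v)^[n] f) ((DD v)^[n] g) U := by
  induction n with
  | zero => simpa using h
  | succ n ih =>
    simp only [Function.iterate_succ_apply']
    exact DD_congr hU v ih

theorem DD_iter_diff {U : Set (ℂ × ℂ)} (hU : IsOpen U) (v : ℂ × ℂ) (n : ℕ) {f : ℂ × ℂ → ℂ}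
    (h : DifferentiableOn ℂ f U) : DifferentiableOn ℂ ((DD v)^[n] f) U := by
  induction n with
  | zero => simpa using h
  | succ n ih =>
    simp only [Function.iterate_succ_apply']
    exact reg_fderiv hU ih v

theorem DD_sum {U : Set (ℂ × ℂ)} (hU : IsOpen U) (v : ℂ × ℂ) (s : Finset ℕ) (a : ℕ → ℂ)
    (f : ℕ → ℂ × ℂ → ℂ) (h : ∀ i, DifferentiableOn ℂ (f i) U) :
    Set.EqOn (DD v (fun p => ∑ i ∈ s, a i * f i p)) (fun p => ∑ i ∈ s, a i * DD v (f i) p) U := by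
  intro p hp
  have hd : ∀ i, HasFDerivAt (f i) (fderiv ℂ (f i) p) p := fun i =>
    ((h i).differentiableAt (hU.mem_nhds hp)).hasFDerivAt
  have : HasFDerivAt (fun p => ∑ i ∈ s, a i * f i p) (∑ i ∈ s, a i • fderiv ℂ (f i) p) p :=
    HasFDerivAt.fun_sum fun i _ => (hd i).const_mul (a i)
  simp only [DD, this.fderiv]
  simp

theorem DD_iter_sum {U : Set (ℂ × ℂ)} (hU : IsOpen U) (v : ℂ × ℂ) (n : ℕ) (s : Finset ℕ)
    (a : ℕ → ℂ) (f : ℕ → ℂ × ℂ → ℂ) (h : ∀ i, DifferentiableOn ℂ (f i) U) :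
    Set.EqOn ((DD v)^[n] (fun p => ∑ i ∈ s, a i * f i p))
      (fun p => ∑ i ∈ s, a i * (DD v)^[n] (f i) p) U := by
  induction n with
  | zero => intro p _; simp
  | succ n ih =>
    simp only [Function.iterate_succ_apply']
    exact (DD_congr hU v ih).trans (DD_sum hU v s a _ fun i => DD_iter_diff hU v n (h i))

/-- coefficients -/
noncomputable def AA (c : ℂ) (b s j : ℕ) : ℂ :=
  (s.choose j : ℂ) * ((b + j).ascFactorial (s - j) : ℂ) * (-c) ^ (s - j)

theorem AA_rec (c : ℂ) (b s j : ℕ) :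
    AA c b (s + 1) (j + 1) = AA c b s (j + 1) * (-(((b + s + (j + 1) : ℕ) : ℂ) * c)) + AA c b s j := by
  unfold AA
  rcases lt_trichotomy j s with h | h | h
  · obtain ⟨d, rfl⟩ : ∃ d, s = j + 1 + d := ⟨s - (j + 1), by omega⟩
    have e1 : j + 1 + d + 1 - (j + 1) = d + 1 := by omega
    have e2 : j + 1 + d - (j + 1) = d := by omega
    have e3 : j + 1 + d - j = d + 1 := by omega
    rw [e1, e2, e3, Nat.choose_succ_succ (j + 1 + d) j]
    have h1 : (b + (j + 1)).ascFactorial (d + 1) = (b + (j + 1) + d) * (b + (j + 1)).ascFactorial d :=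
      Nat.ascFactorial_succ
    have h2 : (b + j).ascFactorial (d + 1) = (b + j) * (b + (j + 1)).ascFactorial d := by
      have := Nat.ascFactorial_mul_ascFactorial (b + j) 1 d
      rw [add_comm d 1, ← this]
      simp [Nat.ascFactorial_succ, add_assoc]
    have h3 : ((j + 1 + d).choose (j + 1) : ℂ) * (j + 1) = ((j + 1 + d).choose j : ℂ) * (d + 1) := by
      have := Nat.choose_succ_right_eq (j + 1 + d) j
      rw [e3] at this
      exact_mod_cast this
    rw [h1, h2]
    push_cast
    simp only [Nat.succ_eq_add_one]
    linear_combination (-c) ^ (d+1) * ((b + (j + 1)).ascFactorial d : ℂ) * (-1) * h3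
  · subst h
    simp
  · simp [Nat.choose_eq_zero_of_lt h, Nat.choose_eq_zero_of_lt (Nat.lt_succ_of_lt h),
      Nat.choose_eq_zero_of_lt (Nat.succ_lt_succ h)]

theorem AA_rec0 (c : ℂ) (b s : ℕ) :
    AA c b (s + 1) 0 = AA c b s 0 * (-(((b + s : ℕ) : ℂ) * c)) := by
  unfold AA
  simp [Nat.ascFactorial_succ, pow_succ]
  ring

theorem AA_zero (c : ℂ) (b s j : ℕ) (h : s < j) : AA c b s j = 0 := by
  simp [AA, Nat.choose_eq_zero_of_lt h]

theorem iter_formula {U : Set (ℂ × ℂ)} (hU : IsOpen U) (v : ℂ × ℂ) (c : ℂ)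
    (T : ℕ → (ℂ × ℂ → ℂ) → ℂ × ℂ → ℂ)
    (hTd : ∀ b G, DifferentiableOn ℂ G U → DifferentiableOn ℂ (T b G) U)
    (hT : ∀ b G, DifferentiableOn ℂ G U → ∀ p ∈ U,
      DD v (T b G) p = -((b : ℂ) * c) * T (b + 1) G p + T (b + 2) (DD v G) p)
    (b s : ℕ) (G : ℂ × ℂ → ℂ) (hG : DifferentiableOn ℂ G U) :
    Set.EqOn ((DD v)^[s] (T b G))
      (fun p => ∑ j ∈ range (s + 1), AA c b s j * T (b + s + j) ((DD v)^[j] G) p) U := by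
  induction s with
  | zero => intro p _; simp [AA]
  | succ s ih =>
    rw [Function.iterate_succ_apply']
    refine (DD_congr hU v ih).trans ((DD_sum hU v _ _ _
      fun j => hTd _ _ (DD_iter_diff hU v j hG)).trans ?_)
    intro p hp
    simp only
    have hstep : ∀ j ∈ range (s + 1), AA c b s j * DD v (T (b + s + j) ((DD v)^[j] G)) p =
        AA c b s j * (-(((b + s + j : ℕ) : ℂ) * c)) * T (b + (s + 1) + j) ((DD v)^[j] G) p
        + AA c b s j * T (b + (s + 1) + (j + 1)) ((DD v)^[j + 1] G) p := by
      intro j _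
      rw [hT _ _ (DD_iter_diff hU v j hG) p hp, Function.iterate_succ_apply']
      rw [show b + (s + 1) + j = b + s + j + 1 by ring,
        show b + (s + 1) + (j + 1) = b + s + j + 2 by ring]
      ring
    rw [sum_congr rfl hstep, sum_add_distrib]
    rw [sum_range_succ' _ (s + 1)]
    simp only [AA_rec, add_mul, sum_add_distrib, AA_rec0]
    have h0 : ∑ j ∈ range (s + 1),
        AA c b s j * (-(((b + s + j : ℕ) : ℂ) * c)) * T (b + (s + 1) + j) ((DD v)^[j] G) p =
      ∑ j ∈ range (s + 1), AA c b s (j + 1) * (-(((b + s + (j + 1) : ℕ) : ℂ) * c)) *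
          T (b + (s + 1) + (j + 1)) ((DD v)^[j + 1] G) p +
        AA c b s 0 * (-(((b + s : ℕ) : ℂ) * c)) * T (b + (s + 1) + 0) ((DD v)^[0] G) p := by
      have := sum_range_succ' (fun j => AA c b s j * (-(((b + s + j : ℕ) : ℂ) * c)) *
        T (b + (s + 1) + j) ((DD v)^[j] G) p) (s + 1)
      simp only [add_zero] at this ⊢
      rw [← this, sum_range_succ _ (s + 1), AA_zero c b s (s + 1) (by omega)]
      simp
    rw [h0]
    ring

/-! ### Möbius part -/

theorem UHP_open : IsOpen UHP := isOpen_lt continuous_const Complex.continuous_im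

theorem den_ne (h : Matrix.SpecialLinearGroup (Fin 2) ℝ) {z : ℂ} (hz : z ∈ UHP) : den h z ≠ 0 := by
  intro h0
  have hz' : 0 < z.im := hz
  have hdet := h.det_coe
  rw [Matrix.det_fin_two] at hdet
  have him := congrArg Complex.im h0
  have hre := congrArg Complex.re h0
  simp [den] at him hre
  rcases him with hc | hc
  · rw [hc] at hre hdet
    simp at hre
    rw [hre] at hdet
    simp at hdet
  · exact hz'.ne' hc

theorem mob_mem (h : Matrix.SpecialLinearGroup (Fin 2) ℝ) {z : ℂ} (hz : z ∈ UHP) :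
    mob h z ∈ UHP := by
  have hz' : 0 < z.im := hz
  have hd := den_ne h hz
  have hdet := h.det_coe
  rw [Matrix.det_fin_two] at hdet
  have hn : 0 < Complex.normSq (den h z) := Complex.normSq_pos.2 hd
  have : (mob h z).im = z.im / Complex.normSq (den h z) := by
    have : mob h z = ((h : Matrix (Fin 2) (Fin 2) ℝ) 0 0 * z + (h : Matrix (Fin 2) (Fin 2) ℝ) 0 1) / den h z := rfl
    rw [this, Complex.div_im, ← sub_div]
    congr 1
    simp [den]
    linear_combination z.im * hdet
  show 0 < (mob h z).im
  rw [this]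
  positivity

theorem affine_hasDeriv (a b z : ℂ) : HasDerivAt (fun z : ℂ => a * z + b) a z := by
  have := ((hasDerivAt_id z).const_mul a).add_const b
  rw [mul_one] at this
  exact this

theorem den_hasDeriv (h : Matrix.SpecialLinearGroup (Fin 2) ℝ) (z : ℂ) :
    HasDerivAt (den h) ((h : Matrix (Fin 2) (Fin 2) ℝ) 1 0 : ℂ) z := by
  exact affine_hasDeriv _ _ z

theorem mob_hasDeriv (h : Matrix.SpecialLinearGroup (Fin 2) ℝ) {z : ℂ} (hz : z ∈ UHP) :
    HasDerivAt (mob h) ((den h z)⁻¹ ^ 2) z := by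
  have hd := den_ne h hz
  have hdet := h.det_coe
  rw [Matrix.det_fin_two] at hdet
  have hdet' : ((h : Matrix (Fin 2) (Fin 2) ℝ) 0 0 : ℂ) * (h : Matrix (Fin 2) (Fin 2) ℝ) 1 1 -
    (h : Matrix (Fin 2) (Fin 2) ℝ) 0 1 * (h : Matrix (Fin 2) (Fin 2) ℝ) 1 0 = 1 := by
    exact_mod_cast hdet
  have hnum : HasDerivAt (fun z : ℂ => ((h : Matrix (Fin 2) (Fin 2) ℝ) 0 0 : ℂ) * z +
      ((h : Matrix (Fin 2) (Fin 2) ℝ) 0 1 : ℂ)) ((h : Matrix (Fin 2) (Fin 2) ℝ) 0 0 : ℂ) z := by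
    exact affine_hasDeriv _ _ z
  have := hnum.div (den_hasDeriv h z) hd
  refine this.congr_deriv ?_
  rw [inv_pow, div_eq_iff (pow_ne_zero 2 hd), inv_mul_cancel₀ (pow_ne_zero 2 hd), ← hdet']
  simp only [den]
  ring

theorem den_pow_hasDeriv (h : Matrix.SpecialLinearGroup (Fin 2) ℝ) (a : ℕ) {z : ℂ} (hz : z ∈ UHP) :
    HasDerivAt (fun z => den h z ^ (-(a : ℤ)))
      (-(a * ((h : Matrix (Fin 2) (Fin 2) ℝ) 1 0 : ℂ)) * den h z ^ (-((a + 1 : ℕ) : ℤ))) z := by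
  have hd := den_ne h hz
  refine ((hasDerivAt_zpow (-(a : ℤ)) (den h z) (Or.inl hd)).comp z (den_hasDeriv h z)).congr_deriv ?_
  rw [show -((a + 1 : ℕ) : ℤ) = -(a : ℤ) - 1 by push_cast; ring]
  push_cast
  ring

noncomputable def TT (h : Matrix.SpecialLinearGroup (Fin 2) ℝ) (a b : ℕ)
    (F : ℂ × ℂ → ℂ) : ℂ × ℂ → ℂ := fun p =>
  den h p.1 ^ (-(a : ℤ)) * den h p.2 ^ (-(b : ℤ)) * F (mob h p.1, mob h p.2)

theorem UU_open : IsOpen (UHP ×ˢ UHP) := UHP_open.prod UHP_open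

theorem TT_diff (h : Matrix.SpecialLinearGroup (Fin 2) ℝ) (a b : ℕ) (G : ℂ × ℂ → ℂ)
    (hG : DifferentiableOn ℂ G (UHP ×ˢ UHP)) :
    DifferentiableOn ℂ (TT h a b G) (UHP ×ˢ UHP) := by
  intro p hp
  apply DifferentiableAt.differentiableWithinAt
  have h1 : DifferentiableAt ℂ (fun p : ℂ × ℂ => den h p.1 ^ (-(a : ℤ))) p :=
    (den_pow_hasDeriv h a hp.1).differentiableAt.comp p differentiableAt_fst
  have h2 : DifferentiableAt ℂ (fun p : ℂ × ℂ => den h p.2 ^ (-(b : ℤ))) p :=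
    (den_pow_hasDeriv h b hp.2).differentiableAt.comp p differentiableAt_snd
  have h3 : DifferentiableAt ℂ (fun p : ℂ × ℂ => mob h p.1) p :=
    (mob_hasDeriv h hp.1).differentiableAt.comp p differentiableAt_fst
  have h4 : DifferentiableAt ℂ (fun p : ℂ × ℂ => mob h p.2) p :=
    (mob_hasDeriv h hp.2).differentiableAt.comp p differentiableAt_snd
  have h5 : DifferentiableAt ℂ G (mob h p.1, mob h p.2) :=
    hG.differentiableAt (UU_open.mem_nhds ⟨mob_mem h hp.1, mob_mem h hp.2⟩)
  have h6 : DifferentiableAt ℂ (fun p : ℂ × ℂ => G (mob h p.1, mob h p.2)) p :=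
    DifferentiableAt.comp (f := fun p : ℂ × ℂ => (mob h p.1, mob h p.2)) p h5 (h3.prodMk h4)
  exact (h1.mul h2).mul h6

theorem TT_dz (h : Matrix.SpecialLinearGroup (Fin 2) ℝ) (a b : ℕ) (G : ℂ × ℂ → ℂ)
    (hG : DifferentiableOn ℂ G (UHP ×ˢ UHP)) (p : ℂ × ℂ) (hp : p ∈ UHP ×ˢ UHP) :
    DD (1, 0) (TT h a b G) p = -((a : ℂ) * ((h : Matrix (Fin 2) (Fin 2) ℝ) 1 0 : ℂ)) *
      TT h (a + 1) b G p + TT h (a + 2) b (DD (1, 0) G) p := by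
  have hT := ((TT_diff h a b G hG).differentiableAt (UU_open.mem_nhds hp)).hasFDerivAt
  have hc : HasDerivAt (fun t : ℂ => (t, p.2)) ((1, 0) : ℂ × ℂ) p.1 :=
    (hasDerivAt_id p.1).prodMk (hasDerivAt_const p.1 p.2)
  have e1 := HasFDerivAt.comp_hasDerivAt (f := fun t : ℂ => (t, p.2)) p.1 hT hc
  have h5 := (hG.differentiableAt (UU_open.mem_nhds (x := (mob h p.1, mob h p.2))
    ⟨mob_mem h hp.1, mob_mem h hp.2⟩)).hasFDerivAt
  have hc2 : HasDerivAt (fun t : ℂ => (mob h t, mob h p.2)) (((den h p.1)⁻¹ ^ 2, 0) : ℂ × ℂ) p.1 :=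
    (mob_hasDeriv h hp.1).prodMk (hasDerivAt_const p.1 _)
  have e2 := HasFDerivAt.comp_hasDerivAt (f := fun t : ℂ => (mob h t, mob h p.2)) p.1 h5 hc2
  have e3 := ((den_pow_hasDeriv h a hp.1).mul_const (den h p.2 ^ (-(b : ℤ)))).mul e2
  have e4 := e1.unique e3
  have hv : (((den h p.1)⁻¹ ^ 2, 0) : ℂ × ℂ) = ((den h p.1)⁻¹ ^ 2) • ((1, 0) : ℂ × ℂ) := by simp
  have hd := den_ne h hp.1
  have hpw : den h p.1 ^ (-((a + 2 : ℕ) : ℤ)) = den h p.1 ^ (-(a : ℤ)) * (den h p.1)⁻¹ ^ 2 := by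
    rw [show -((a + 2 : ℕ) : ℤ) = -(a : ℤ) + -2 by push_cast; ring, zpow_add₀ hd, inv_pow, zpow_neg (den h p.1) 2]
    norm_cast
  rw [hv, map_smul, smul_eq_mul] at e4
  simp only [DD, TT]
  rw [hpw]
  refine e4.trans ?_
  simp only [Function.comp_apply]
  ring

theorem TT_dw (h : Matrix.SpecialLinearGroup (Fin 2) ℝ) (a b : ℕ) (G : ℂ × ℂ → ℂ)
    (hG : DifferentiableOn ℂ G (UHP ×ˢ UHP)) (p : ℂ × ℂ) (hp : p ∈ UHP ×ˢ UHP) :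
    DD (0, 1) (TT h a b G) p = -((b : ℂ) * ((h : Matrix (Fin 2) (Fin 2) ℝ) 1 0 : ℂ)) *
      TT h a (b + 1) G p + TT h a (b + 2) (DD (0, 1) G) p := by
  have hT := ((TT_diff h a b G hG).differentiableAt (UU_open.mem_nhds hp)).hasFDerivAt
  have hc : HasDerivAt (fun t : ℂ => (p.1, t)) ((0, 1) : ℂ × ℂ) p.2 :=
    (hasDerivAt_const p.2 p.1).prodMk (hasDerivAt_id p.2)
  have e1 := HasFDerivAt.comp_hasDerivAt (f := fun t : ℂ => (p.1, t)) p.2 hT hc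
  have h5 := (hG.differentiableAt (UU_open.mem_nhds (x := (mob h p.1, mob h p.2))
    ⟨mob_mem h hp.1, mob_mem h hp.2⟩)).hasFDerivAt
  have hc2 : HasDerivAt (fun t : ℂ => (mob h p.1, mob h t)) ((0, (den h p.2)⁻¹ ^ 2) : ℂ × ℂ) p.2 :=
    (hasDerivAt_const p.2 _).prodMk (mob_hasDeriv h hp.2)
  have e2 := HasFDerivAt.comp_hasDerivAt (f := fun t : ℂ => (mob h p.1, mob h t)) p.2 h5 hc2
  have e3 := ((den_pow_hasDeriv h b hp.2).const_mul (den h p.1 ^ (-(a : ℤ)))).mul e2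
  have e4 := e1.unique e3
  have hv : ((0, (den h p.2)⁻¹ ^ 2) : ℂ × ℂ) = ((den h p.2)⁻¹ ^ 2) • ((0, 1) : ℂ × ℂ) := by simp
  have hd := den_ne h hp.2
  have hpw : den h p.2 ^ (-((b + 2 : ℕ) : ℤ)) = den h p.2 ^ (-(b : ℤ)) * (den h p.2)⁻¹ ^ 2 := by
    rw [show -((b + 2 : ℕ) : ℤ) = -(b : ℤ) + -2 by push_cast; ring, zpow_add₀ hd, inv_pow, zpow_neg (den h p.2) 2]
    norm_cast
  rw [hv, map_smul, smul_eq_mul] at e4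
  simp only [DD, TT]
  rw [hpw]
  refine e4.trans ?_
  simp only [Function.comp_apply]
  ring

theorem double_formula (h : Matrix.SpecialLinearGroup (Fin 2) ℝ) (l m r s : ℕ) (F : ℂ × ℂ → ℂ)
    (hF : DifferentiableOn ℂ F (UHP ×ˢ UHP)) (p : ℂ × ℂ) (hp : p ∈ UHP ×ˢ UHP) (c : ℂ)
    (hc : c = ((h : Matrix (Fin 2) (Fin 2) ℝ) 1 0 : ℂ)) :
    ((DD (1, 0))^[r] ((DD (0, 1))^[s] (TT h l m F))) p =
      ∑ j ∈ range (s + 1), AA c m s j * ∑ i ∈ range (r + 1), AA c l r i *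
        TT h (l + r + i) (m + s + j) ((DD (1, 0))^[i] ((DD (0, 1))^[j] F)) p := by
  subst hc
  have h1 := iter_formula UU_open (0, 1) _ (fun b => TT h l b) (fun b => TT_diff h l b)
    (fun b G hG p hp => TT_dw h l b G hG p hp) m s F hF
  have h2 := DD_iter_congr UU_open (1, 0) r h1
  rw [h2 hp, DD_iter_sum UU_open (1, 0) r _ _ _
    (fun j => TT_diff h l _ _ (DD_iter_diff UU_open (0, 1) j hF)) hp]
  refine sum_congr rfl fun j _ => ?_
  rw [iter_formula UU_open (1, 0) _ (fun a => TT h a (m + s + j))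
    (fun a => TT_diff h a (m + s + j))
    (fun a G hG p hp => TT_dz h a (m + s + j) G hG p hp) l r _ 
    (DD_iter_diff UU_open (0, 1) j hF) hp]

/-! ### Combinatorics -/

theorem comb_term (c : ℂ) (l m k r i j : ℕ) (hi : i ≤ r) (hr : r ≤ k) (hj : j ≤ k - r) :
    ((l + k - 1).choose (k - r) : ℂ) * ((m + k - 1).choose r : ℂ) *
      (AA c m (k - r) j * AA c l r i) =
    (-c) ^ (k - i - j) * (((l + i).ascFactorial (k - i) : ℂ) * ((m + j).ascFactorial (k - j) : ℂ) /
      (i.factorial * j.factorial * (k - i - j).factorial)) * ((k - i - j).choose (r - i) : ℂ) := by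
  obtain ⟨a, rfl⟩ : ∃ a, r = i + a := ⟨r - i, by omega⟩
  obtain ⟨b, rfl⟩ : ∃ b, k = i + a + (j + b) := ⟨k - (i + a) - j, by omega⟩
  unfold AA
  have e1 : i + a + (j + b) - (i + a) = j + b := by omega
  have e2 : j + b - j = b := by omega
  have e3 : i + a - i = a := by omega
  have e4 : i + a + (j + b) - i - j = a + b := by omega
  have e5 : i + a + (j + b) - i = a + (j + b) := by omega
  have e6 : i + a + (j + b) - j = b + (i + a) := by omega
  rw [e1, e2, e4, e3, e5, e6]
  have h1 := Nat.ascFactorial_mul_ascFactorial (l + i) a (j + b)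
  have h2 := Nat.ascFactorial_mul_ascFactorial (m + j) b (i + a)
  have h3 := Nat.ascFactorial_eq_factorial_mul_choose' (l + i + a) (j + b)
  have h4 := Nat.ascFactorial_eq_factorial_mul_choose' (m + j + b) (i + a)
  rw [show l + i + a + (j + b) - 1 = l + (i + a + (j + b)) - 1 by congr 1; ring] at h3
  rw [show m + j + b + (i + a) - 1 = m + (i + a + (j + b)) - 1 by congr 1; ring] at h4
  rw [← h1, ← h2, h3, h4, Nat.cast_add_choose, Nat.cast_add_choose, Nat.cast_add_choose]
  have f : ∀ n : ℕ, (n.factorial : ℂ) ≠ 0 := fun n => by exact_mod_cast n.factorial_ne_zero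
  have := f i; have := f j; have := f a; have := f b; have := f (a + b)
  have := f (i + a); have := f (j + b)
  push_cast
  rw [pow_add]
  field_simp

theorem comb_sum (c : ℂ) (l m k i j : ℕ) :
    ∑ r ∈ range (k + 1), (-1 : ℂ) ^ r * ((l + k - 1).choose (k - r) : ℂ) *
      ((m + k - 1).choose r : ℂ) * (AA c m (k - r) j * AA c l r i) =
    if i + j = k then (-1 : ℂ) ^ i * ((l + k - 1).choose (k - i) : ℂ) *
      ((m + k - 1).choose i : ℂ) else 0 := by
  have hz : ∀ r, r ≤ k → (r < i ∨ k - r < j) → (-1 : ℂ) ^ r * ((l + k - 1).choose (k - r) : ℂ) *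
      ((m + k - 1).choose r : ℂ) * (AA c m (k - r) j * AA c l r i) = 0 := by
    rintro r _ (h | h)
    · rw [AA_zero c l r i h]; simp
    · rw [AA_zero c m _ j h]; simp
  by_cases hk : i + j = k
  · rw [if_pos hk, sum_eq_single i]
    · subst hk
      simp [AA]
    · intro r hr hne
      rw [mem_range] at hr
      exact hz r (by omega) (by omega)
    · intro h; exact absurd (mem_range.2 (by omega)) h
  rw [if_neg hk]
  by_cases hlt : k < i + j
  · refine sum_eq_zero fun r hr => ?_
    rw [mem_range] at hr
    exact hz r (by omega) (by omega)
  obtain ⟨n, rfl⟩ : ∃ n, k = i + j + n := ⟨k - (i + j), by omega⟩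
  have hn : n ≠ 0 := by omega
  have hsub : ∑ t ∈ range (n + 1), (-1 : ℂ) ^ (i + t) *
      ((l + (i + j + n) - 1).choose ((i + j + n) - (i + t)) : ℂ) *
      ((m + (i + j + n) - 1).choose (i + t) : ℂ) *
      (AA c m ((i + j + n) - (i + t)) j * AA c l (i + t) i) = 0 := by
    set K := (-c) ^ (i + j + n - i - j) * (((l + i).ascFactorial (i + j + n - i) : ℂ) *
      ((m + j).ascFactorial (i + j + n - j) : ℂ) /
      (i.factorial * j.factorial * (i + j + n - i - j).factorial)) with hK
    have : ∀ t ∈ range (n + 1), (-1 : ℂ) ^ (i + t) *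
      ((l + (i + j + n) - 1).choose ((i + j + n) - (i + t)) : ℂ) *
      ((m + (i + j + n) - 1).choose (i + t) : ℂ) *
      (AA c m ((i + j + n) - (i + t)) j * AA c l (i + t) i) =
        (-1) ^ i * K * ((-1) ^ t * (n.choose t : ℂ)) := by
      intro t ht
      rw [mem_range] at ht
      have := comb_term c l m (i + j + n) (i + t) i j (by omega) (by omega) (by omega)
      rw [← hK, show i + j + n - i - j = n by omega, show i + t - i = t by omega] at this
      rw [mul_assoc ((-1 : ℂ) ^ (i + t)), mul_assoc ((-1 : ℂ) ^ (i + t)), this, pow_add]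
      ring
    rw [sum_congr rfl this, ← mul_sum]
    have h0 := Int.alternating_sum_range_choose_of_ne hn
    have h1 : ∑ t ∈ range (n + 1), ((-1 : ℂ) ^ t * (n.choose t : ℂ)) = 0 := by
      exact_mod_cast congrArg (Int.cast : ℤ → ℂ) h0
    rw [h1, mul_zero]
  rw [← hsub]
  symm
  refine sum_of_injOn (fun t => i + t) ?_ ?_ ?_ ?_
  · intro a _ b _ hab
    simpa using hab
  · intro t ht
    simp only [coe_range, Set.mem_Iio] at ht ⊢
    omega
  · intro r hr hnot
    rw [mem_range] at hr
    apply hz r (by omega)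
    by_contra hcon
    push Not at hcon
    apply hnot
    refine ⟨r - i, ?_, ?_⟩
    · simp only [coe_range, Set.mem_Iio]; omega
    · simp only; omega
  · intro t _; rfl

/-- the Rankin–Cohen bracket `B_{ℓ,m}^{(k)}` is a symmetry breaking operator:
`B ∘ (π_ℓ(g) ⊗ π_m(g)) = π_{ℓ+m+2k}(g) ∘ B` for all `g ∈ SL(2,ℝ)`, on holomorphic
functions on `Π × Π`. -/
theorem stmt_0 (ℓ m k : ℕ) (F : ℂ × ℂ → ℂ)
    (hF : DifferentiableOn ℂ F (UHP ×ˢ UHP))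
    (g : Matrix.SpecialLinearGroup (Fin 2) ℝ) (z : ℂ) (hz : z ∈ UHP) :
    RC ℓ m k (piTensorAct ℓ m g F) z = piAct (ℓ + m + 2 * k) g (RC ℓ m k F) z := by
  have hRC : ∀ G, RC ℓ m k G = fun z => ∑ r ∈ range (k + 1),
      (-1 : ℂ) ^ r * (Nat.choose (ℓ + k - 1) (k - r) : ℂ) * (Nat.choose (m + k - 1) r : ℂ) *
      ((DD (1, 0))^[r] ((DD (0, 1))^[k - r] G)) (z, z) := fun G => rfl
  have hTT : piTensorAct ℓ m g F = TT g⁻¹ ℓ m F := rfl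
  rw [hTT]
  simp only [piAct, hRC]
  generalize g⁻¹ = h
  have hp : (z, z) ∈ UHP ×ˢ UHP := ⟨hz, hz⟩
  have hd := den_ne h hz
  obtain ⟨c, hc⟩ : ∃ c : ℂ, c = ((h : Matrix (Fin 2) (Fin 2) ℝ) 1 0 : ℂ) := ⟨_, rfl⟩
  set P : ℕ → ℕ → ℂ := fun i j =>
    ((DD (1, 0))^[i] ((DD (0, 1))^[j] F)) (mob h z, mob h z) with hP
  set J : ℕ → ℂ := fun n => den h z ^ (-(n : ℤ)) with hJ
  have hT : ∀ a b i j, TT h a b ((DD (1, 0))^[i] ((DD (0, 1))^[j] F)) (z, z) =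
      J (a + b) * P i j := by
    intro a b i j
    simp only [TT, hJ, hP]
    rw [← zpow_add₀ hd]
    congr 2
    push_cast; ring
  have step : ∀ r ∈ range (k + 1),
      (-1 : ℂ) ^ r * (Nat.choose (ℓ + k - 1) (k - r) : ℂ) * (Nat.choose (m + k - 1) r : ℂ) *
      ((DD (1, 0))^[r] ((DD (0, 1))^[k - r] (TT h ℓ m F))) (z, z) =
      ∑ i ∈ range (k + 1), ∑ j ∈ range (k + 1),
        (-1 : ℂ) ^ r * (Nat.choose (ℓ + k - 1) (k - r) : ℂ) * (Nat.choose (m + k - 1) r : ℂ) *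
        (AA c m (k - r) j * AA c ℓ r i) * (J (ℓ + m + k + i + j) * P i j) := by
    intro r hr
    rw [mem_range] at hr
    rw [double_formula h ℓ m r (k - r) F hF (z, z) hp c hc, sum_comm, mul_sum]
    have hsub1 : range (k - r + 1) ⊆ range (k + 1) := range_subset_range.2 (by omega)
    have hsub2 : range (r + 1) ⊆ range (k + 1) := range_subset_range.2 (by omega)
    rw [← sum_subset hsub1]
    · refine sum_congr rfl fun j _ => ?_
      rw [← sum_subset hsub2]
      · rw [mul_sum, mul_sum]
        refine sum_congr rfl fun i _ => ?_
        rw [hT, show ℓ + r + i + (m + (k - r) + j) = ℓ + m + k + i + j by omega]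
        ring
      · intro i _ hi
        rw [mem_range] at hi
        rw [AA_zero c ℓ r i (by omega)]; simp
    · intro j _ hj
      rw [mem_range] at hj
      refine sum_eq_zero fun i _ => ?_
      rw [AA_zero c m _ j (by omega)]; simp
  rw [sum_congr rfl step, sum_comm, mul_sum]
  refine sum_congr rfl fun i hi => ?_
  rw [mem_range] at hi
  rw [sum_comm]
  simp only [← sum_mul, comb_sum]
  rw [sum_eq_single (k - i)]
  · rw [if_pos (by omega), show ℓ + m + k + i + (k - i) = ℓ + m + 2 * k by omega]
    simp only [hJ, hP]
    ring
  · intro j _ hne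
    rw [if_neg (by omega), zero_mul]
  · intro hne
    exact absurd (mem_range.2 (by omega)) hne
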